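/- arXiv:1906.00344 — 2 statements merged into one kernel-verified Lean document; each statement's English description precedes it below -/
import Mathlib

section
/- Let w ∈ ℂ with Re w > 0, let n ≥ 0 be an integer, and let λ > 0. Then ∫_λ^∞ e^{−wt} t^{−n−1} dt + (1/(2πi)) ∫_0^{2π} exp(−wλe^{iθ}) λ^{−n} e^{−inθ} (log λ + iθ) i dθ + (γ − πi)·(−w)^n/n! = ((−1)^n/n!) · (H_n − Log w) · w^n, where H_n = ∑_{j=1}^n 1/j (H_0 = 0), γ is the Euler–Mascheroni constant, and Log is the principal logarithm. (The left-hand side is P_0(n,w;∅), since f_∅ ≡ 1 and a_{0,n}(w;∅) = (−w)^n/n!.) -/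
open MeasureTheory

open Set Filter Topology Metric

theorem hasDerivAt_mul_exp_I_mul (c : ℂ) (θ : ℝ) :
    HasDerivAt (fun x : ℝ => c * Complex.exp (Complex.I * x))
      (Complex.I * (c * Complex.exp (Complex.I * θ))) θ := by
  have h : HasDerivAt (fun x : ℝ => Complex.I * (x : ℂ)) (Complex.I * 1) θ :=
    (Complex.ofRealCLM.hasDerivAt (x := θ)).const_mul _
  exact (h.cexp.const_mul c).congr_deriv (by ring)

/-- Mean value property on a circle centred at the origin. -/
theorem integral_circle_eq_two_pi_mul {f : ℂ → ℂ} {r : ℝ} (hr : 0 < r)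
    (hf : ∀ z, ‖z‖ ≤ r → DifferentiableAt ℂ f z) :
    ∫ θ in (0:ℝ)..(2 * Real.pi), f (r * Complex.exp (Complex.I * θ)) = 2 * Real.pi * f 0 := by
  have hd : DiffContOnCl ℂ f (ball 0 |r|) := by
    apply DifferentiableOn.diffContOnCl
    intro z hz
    rw [closure_ball _ (by positivity)] at hz
    exact (hf z (by simpa [abs_of_pos hr] using hz)).differentiableWithinAt
  have h := hd.circleAverage
  rw [Real.circleAverage_def, inv_smul_eq_iff₀ (by positivity)] at h
  simpa [circleMap, mul_comm] using h

/-- Derivative along the circle of the integrand of the coefficient integral. -/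
theorem hasDerivAt_exp_mul_circle_inv_pow (w : ℂ) {c : ℂ} (hc : c ≠ 0) (n : ℕ) (θ : ℝ) :
    HasDerivAt (fun x : ℝ => Complex.exp (-w * (c * Complex.exp (Complex.I * x))) *
        ((c * Complex.exp (Complex.I * x)) ^ (n + 1))⁻¹)
      (Complex.I * (-w * (Complex.exp (-w * (c * Complex.exp (Complex.I * θ))) *
          ((c * Complex.exp (Complex.I * θ)) ^ n)⁻¹) -
        (n + 1) * (Complex.exp (-w * (c * Complex.exp (Complex.I * θ))) *
          ((c * Complex.exp (Complex.I * θ)) ^ (n + 1))⁻¹))) θ := by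
  have hz := hasDerivAt_mul_exp_I_mul c θ
  have hne : c * Complex.exp (Complex.I * θ) ≠ 0 := mul_ne_zero hc (Complex.exp_ne_zero _)
  refine ((hz.const_mul (-w)).cexp.mul ((hz.pow (n + 1)).inv (pow_ne_zero _ hne))).congr_deriv ?_
  simp only [Pi.pow_apply, Pi.inv_apply, Nat.add_sub_cancel]
  generalize c * Complex.exp (Complex.I * θ) = z at hne ⊢
  push_cast
  field_simp
  ring

theorem continuous_exp_mul_circle_inv_pow (w : ℂ) {c : ℂ} (hc : c ≠ 0) (n : ℕ) :
    Continuous (fun x : ℝ => Complex.exp (-w * (c * Complex.exp (Complex.I * x))) *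
        ((c * Complex.exp (Complex.I * x)) ^ n)⁻¹) := by
  refine Continuous.mul (by fun_prop) (Continuous.inv₀ (by fun_prop) fun x => ?_)
  exact pow_ne_zero _ (mul_ne_zero hc (Complex.exp_ne_zero _))

theorem exp_I_mul_two_pi : Complex.exp (Complex.I * ((2 * Real.pi : ℝ) : ℂ)) = 1 := by
  rw [mul_comm]; push_cast; exact Complex.exp_two_pi_mul_I

/-- Cauchy's formula for the Taylor coefficients of `z ↦ exp (-w z)`. -/
theorem integral_exp_mul_circle_inv_pow (w : ℂ) {r : ℝ} (hr : 0 < r) (n : ℕ) :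
    ∫ θ in (0:ℝ)..(2 * Real.pi), Complex.exp (-w * (r * Complex.exp (Complex.I * θ))) *
        ((r * Complex.exp (Complex.I * θ)) ^ n)⁻¹ =
      2 * Real.pi * ((-w) ^ n / (n.factorial : ℂ)) := by
  have hc : (r : ℂ) ≠ 0 := by exact_mod_cast hr.ne'
  induction n with
  | zero =>
    have := integral_circle_eq_two_pi_mul (f := fun z => Complex.exp (-w * z)) hr
      (fun z _ => by fun_prop)
    simpa using this
  | succ n ih =>
    have hC := continuous_exp_mul_circle_inv_pow w hc
    have h := intervalIntegral.integral_eq_sub_of_hasDerivAt (a := 0) (b := 2 * Real.pi)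
      (fun θ _ => hasDerivAt_exp_mul_circle_inv_pow w hc n θ)
      ((((hC n).const_mul _).fun_sub ((hC (n + 1)).const_mul _)).const_mul _
        |>.intervalIntegrable _ _)
    rw [intervalIntegral.integral_const_mul, intervalIntegral.integral_sub
      (((hC n).const_mul _).intervalIntegrable _ _)
      (((hC (n + 1)).const_mul _).intervalIntegrable _ _),
      intervalIntegral.integral_const_mul, intervalIntegral.integral_const_mul, ih,
      exp_I_mul_two_pi] at h
    simp only [Complex.ofReal_zero, mul_zero, Complex.exp_zero, sub_self, mul_eq_zero,
      Complex.I_ne_zero, false_or] at h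
    have hn : (n + 1 : ℂ) ≠ 0 := by exact_mod_cast n.succ_ne_zero
    apply mul_left_cancel₀ hn
    rw [← sub_eq_zero.1 h, Nat.factorial_succ]
    have := n.factorial_ne_zero
    push_cast
    field_simp
    ring

/-- Integration by parts for the circle part of the Hankel contour integral. -/
theorem integral_circle_log_succ (w : ℂ) {r : ℝ} (hr : 0 < r) (n : ℕ) (L : ℂ) :
    (n + 1) * ∫ θ in (0:ℝ)..(2 * Real.pi),
        Complex.exp (-w * (r * Complex.exp (Complex.I * θ))) *
        ((r * Complex.exp (Complex.I * θ)) ^ (n + 1))⁻¹ * (L + Complex.I * θ) =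
      -w * (∫ θ in (0:ℝ)..(2 * Real.pi),
        Complex.exp (-w * (r * Complex.exp (Complex.I * θ))) *
        ((r * Complex.exp (Complex.I * θ)) ^ n)⁻¹ * (L + Complex.I * θ)) +
      2 * Real.pi * ((-w) ^ (n + 1) / ((n + 1).factorial : ℂ)) -
      2 * Real.pi * (Complex.exp (-w * r) * ((r : ℂ) ^ (n + 1))⁻¹) := by
  have hc : (r : ℂ) ≠ 0 := by exact_mod_cast hr.ne'
  have hC := continuous_exp_mul_circle_inv_pow w hc
  have hl : ∀ θ : ℝ, HasDerivAt (fun x : ℝ => L + Complex.I * (x : ℂ)) Complex.I θ := fun θ => by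
    simpa using ((Complex.ofRealCLM.hasDerivAt (x := θ)).const_mul Complex.I).const_add L
  have hlc : Continuous (fun x : ℝ => L + Complex.I * (x : ℂ)) := by fun_prop
  have hM : ∀ k : ℕ, Continuous (fun x : ℝ =>
      Complex.exp (-w * (r * Complex.exp (Complex.I * x))) *
        ((r * Complex.exp (Complex.I * x)) ^ k)⁻¹ * (L + Complex.I * x)) :=
    fun k => (hC k).mul hlc
  have h := intervalIntegral.integral_eq_sub_of_hasDerivAt (a := 0) (b := 2 * Real.pi)
    (f' := fun θ : ℝ => Complex.I * (-w * (Complex.exp (-w * (r * Complex.exp (Complex.I * θ))) *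
        ((r * Complex.exp (Complex.I * θ)) ^ n)⁻¹ * (L + Complex.I * θ)) -
      (n + 1) * (Complex.exp (-w * (r * Complex.exp (Complex.I * θ))) *
        ((r * Complex.exp (Complex.I * θ)) ^ (n + 1))⁻¹ * (L + Complex.I * θ)) +
      Complex.exp (-w * (r * Complex.exp (Complex.I * θ))) *
        ((r * Complex.exp (Complex.I * θ)) ^ (n + 1))⁻¹))
    (fun θ _ => ((hasDerivAt_exp_mul_circle_inv_pow w hc n θ).mul (hl θ)).congr_deriv (by ring))
    (((((hM n).const_mul _).fun_sub ((hM (n + 1)).const_mul _)).fun_add (hC (n + 1))).const_mul _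
      |>.intervalIntegrable _ _)
  rw [intervalIntegral.integral_const_mul, intervalIntegral.integral_add
      ((((hM n).const_mul _).fun_sub ((hM (n + 1)).const_mul _)).intervalIntegrable _ _)
      ((hC (n + 1)).intervalIntegrable _ _), intervalIntegral.integral_sub
      (((hM n).const_mul _).intervalIntegrable _ _)
      (((hM (n + 1)).const_mul _).intervalIntegrable _ _),
      intervalIntegral.integral_const_mul, intervalIntegral.integral_const_mul,
      integral_exp_mul_circle_inv_pow w hr] at h
  simp only [Pi.mul_apply, exp_I_mul_two_pi, Complex.ofReal_zero, mul_zero, Complex.exp_zero,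
    mul_one, add_zero] at h
  have h2 := mul_left_cancel₀ Complex.I_ne_zero (h.trans
    (b := _) (c := Complex.I * (2 * Real.pi * (Complex.exp (-w * r) * ((r : ℂ) ^ (n + 1))⁻¹)))
    (by push_cast; ring))
  linear_combination -h2

theorem norm_exp_neg_mul_ofReal (w : ℂ) (t : ℝ) :
    ‖Complex.exp (-w * t)‖ = Real.exp (-w.re * t) := by
  simp [Complex.norm_exp]

theorem norm_exp_mul_inv_pow_le (w : ℂ) {r t : ℝ} (hr : 0 < r) (ht : r ≤ t) (n : ℕ) :
    ‖Complex.exp (-w * t) * ((t : ℂ) ^ n)⁻¹‖ ≤ Real.exp (-w.re * t) * (r ^ n)⁻¹ := by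
  rw [norm_mul, norm_exp_neg_mul_ofReal, norm_inv, norm_pow, Complex.norm_real,
    Real.norm_of_nonneg (hr.le.trans ht)]
  gcongr

theorem integrableOn_exp_mul_inv_pow {w : ℂ} (hw : 0 < w.re) {r : ℝ} (hr : 0 < r) (n : ℕ) :
    IntegrableOn (fun t : ℝ => Complex.exp (-w * t) * ((t : ℂ) ^ n)⁻¹) (Ioi r) := by
  refine Integrable.mono' (g := fun t => Real.exp (-w.re * t) * (r ^ n)⁻¹)
    ((integrableOn_exp_mul_Ioi (by simpa) r).mul_const _) ?_ ?_
  · exact Measurable.aestronglyMeasurable (by fun_prop)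
  · filter_upwards [ae_restrict_mem measurableSet_Ioi] with t ht
    exact norm_exp_mul_inv_pow_le w hr (le_of_lt ht) n

theorem tendsto_exp_mul_inv_pow_atTop {w : ℂ} (hw : 0 < w.re) (n : ℕ) :
    Tendsto (fun t : ℝ => Complex.exp (-w * t) * ((t : ℂ) ^ n)⁻¹) atTop (𝓝 0) := by
  refine squeeze_zero_norm' (a := fun t => Real.exp (-w.re * t)) ?_ ?_
  · filter_upwards [eventually_ge_atTop 1] with t ht
    simpa using norm_exp_mul_inv_pow_le w one_pos ht n
  · simpa using tendsto_rpow_mul_exp_neg_mul_atTop_nhds_zero 0 w.re hw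

/-- Integration by parts for the half-line part of the Hankel contour integral. -/
theorem integral_Ioi_exp_mul_inv_pow_succ {w : ℂ} (hw : 0 < w.re) {r : ℝ} (hr : 0 < r) (n : ℕ) :
    (n + 1) * ∫ t in Ioi r, Complex.exp (-w * t) * ((t : ℂ) ^ (n + 2))⁻¹ =
      -w * (∫ t in Ioi r, Complex.exp (-w * t) * ((t : ℂ) ^ (n + 1))⁻¹) +
      Complex.exp (-w * r) * ((r : ℂ) ^ (n + 1))⁻¹ := by
  have hI := integrableOn_exp_mul_inv_pow hw hr
  have h := integral_Ioi_of_hasDerivAt_of_tendsto' (a := r)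
    (f := fun t : ℝ => Complex.exp (-w * t) * ((t : ℂ) ^ (n + 1))⁻¹)
    (f' := fun t : ℝ => -w * (Complex.exp (-w * t) * ((t : ℂ) ^ (n + 1))⁻¹) -
      (n + 1) * (Complex.exp (-w * t) * ((t : ℂ) ^ (n + 2))⁻¹))
    (fun t ht => ?_) (((hI _).const_mul _).sub ((hI _).const_mul _))
    (tendsto_exp_mul_inv_pow_atTop hw _)
  · rw [integral_sub ((hI _).const_mul _) ((hI _).const_mul _), integral_const_mul,
      integral_const_mul] at h
    linear_combination -h
  · have hne : (t : ℂ) ≠ 0 := by exact_mod_cast (hr.trans_le ht).ne'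
    have ht' := Complex.ofRealCLM.hasDerivAt (x := t)
    refine ((ht'.const_mul (-w)).cexp.mul
      ((ht'.pow (n + 1)).inv (pow_ne_zero _ hne))).congr_deriv ?_
    simp only [Complex.ofRealCLM_apply, Pi.pow_apply, Pi.inv_apply, Nat.add_sub_cancel, Complex.ofReal_one]
    push_cast
    field_simp
    ring

/-- A primitive of `(exp (-z) - 1) / z` on a disc around the origin, vanishing at the origin. -/
theorem exists_primitive_exp_neg_sub_one_div (R : ℝ) :
    ∃ G : ℂ → ℂ, G 0 = 0 ∧ (∀ z ∈ ball (0 : ℂ) R, DifferentiableAt ℂ G z) ∧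
      ∀ z ∈ ball (0 : ℂ) R, z ≠ 0 → HasDerivAt G ((Complex.exp (-z) - 1) / z) z := by
  rcases le_or_gt R 0 with hR | hR
  · exact ⟨0, rfl, by simp [ball_eq_empty.2 hR]⟩
  have hd : DifferentiableOn ℂ (dslope (fun z : ℂ => Complex.exp (-z)) 0) (ball 0 R) :=
    (Complex.differentiableOn_dslope (ball_mem_nhds 0 hR)).2 (by fun_prop)
  obtain ⟨G, hG0, hG⟩ := hd.isExactOn_ball.with_val_at 0 0
  refine ⟨G, hG0, fun z hz => (hG z hz).differentiableAt, fun z hz hz0 => ?_⟩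
  refine (hG z hz).congr_deriv ?_
  rw [dslope_of_ne _ hz0, slope_def_field]
  simp

/-- The circle part of the Hankel contour integral at `n = 0`. -/
theorem integral_circle_log_zero {w : ℂ} (hw : w ≠ 0) {r R : ℝ} (hr : 0 < r) (hR : ‖w‖ * r < R)
    (L : ℂ) {G : ℂ → ℂ} (hG0 : G 0 = 0) (hGd : ∀ z ∈ ball (0 : ℂ) R, DifferentiableAt ℂ G z)
    (hG : ∀ z ∈ ball (0 : ℂ) R, z ≠ 0 → HasDerivAt G ((Complex.exp (-z) - 1) / z) z) :
    ∫ θ in (0:ℝ)..(2 * Real.pi),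
        Complex.exp (-w * (r * Complex.exp (Complex.I * θ))) * (L + Complex.I * θ) =
      2 * Real.pi * (L + Real.pi * Complex.I + G (w * r)) := by
  have hc : (r : ℂ) ≠ 0 := by exact_mod_cast hr.ne'
  have hball : ∀ z : ℂ, ‖z‖ ≤ r → w * z ∈ ball (0 : ℂ) R := fun z hz => by
    rw [mem_ball_zero_iff, norm_mul]
    exact (mul_le_mul_of_nonneg_left hz (norm_nonneg _)).trans_lt hR
  have hcirc : ∀ θ : ℝ, ‖(r : ℂ) * Complex.exp (Complex.I * θ)‖ ≤ r := fun θ => by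
    rw [norm_mul, mul_comm Complex.I, Complex.norm_exp_ofReal_mul_I]
    simp [abs_of_pos hr]
  have hGmean := integral_circle_eq_two_pi_mul (f := fun z => G (w * z)) hr
    (fun z hz => (hGd _ (hball z hz)).fun_comp' z (by fun_prop))
  have hE := integral_exp_mul_circle_inv_pow w hr 0
  simp only [pow_zero, inv_one, mul_one, Nat.factorial_zero, Nat.cast_one, div_one] at hE
  have hGc : Continuous (fun θ : ℝ => G (w * (r * Complex.exp (Complex.I * θ)))) :=
    continuous_iff_continuousAt.2 fun θ =>
      (hGd _ (hball _ (hcirc θ))).continuousAt.comp_of_eq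
        (f := fun θ : ℝ => w * (r * Complex.exp (Complex.I * θ))) (by fun_prop) rfl
  have hEc : Continuous (fun θ : ℝ => Complex.exp (-w * (r * Complex.exp (Complex.I * θ)))) := by
    fun_prop
  have h1 : Continuous (fun θ : ℝ => Complex.exp (-w * (r * Complex.exp (Complex.I * θ))) *
      (L + Complex.I * θ)) := by fun_prop
  have h2 : Continuous (fun θ : ℝ => L * Complex.exp (-w * (r * Complex.exp (Complex.I * θ)))) := by
    fun_prop
  have h3 : Continuous (fun θ : ℝ => Complex.I * (θ : ℂ)) := by fun_prop
  have h := intervalIntegral.integral_eq_sub_of_hasDerivAt (a := 0) (b := 2 * Real.pi)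
    (f := fun θ : ℝ => (θ : ℂ) * G (w * (r * Complex.exp (Complex.I * θ))))
    (f' := fun θ : ℝ => G (w * (r * Complex.exp (Complex.I * θ))) +
      (Complex.exp (-w * (r * Complex.exp (Complex.I * θ))) * (L + Complex.I * θ) -
        L * Complex.exp (-w * (r * Complex.exp (Complex.I * θ))) - Complex.I * θ))
    (fun θ _ => by
      have hne : w * (r * Complex.exp (Complex.I * θ)) ≠ 0 :=
        mul_ne_zero hw (mul_ne_zero hc (Complex.exp_ne_zero _))
      have hGθ := (hG _ (hball _ (hcirc θ)) hne).comp θ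
        ((hasDerivAt_mul_exp_I_mul (r : ℂ) θ).const_mul w)
      refine ((Complex.ofRealCLM.hasDerivAt (x := θ)).mul hGθ).congr_deriv ?_
      simp only [Complex.ofRealCLM_apply, Complex.ofReal_one, Function.comp_apply, neg_mul]
      field_simp
      ring)
    ((hGc.fun_add ((h1.fun_sub h2).fun_sub h3)).intervalIntegrable _ _)
  rw [intervalIntegral.integral_add (hGc.intervalIntegrable _ _)
      (((h1.fun_sub h2).fun_sub h3).intervalIntegrable _ _),
    intervalIntegral.integral_sub ((h1.fun_sub h2).intervalIntegrable _ _)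
      (h3.intervalIntegrable _ _),
    intervalIntegral.integral_sub (h1.intervalIntegrable _ _) (h2.intervalIntegrable _ _),
    intervalIntegral.integral_const_mul, intervalIntegral.integral_const_mul, hE, hGmean,
    intervalIntegral.integral_ofReal, integral_id, exp_I_mul_two_pi] at h
  simp only [mul_zero, hG0, Complex.ofReal_zero, zero_mul, mul_one] at h
  push_cast at h
  linear_combination h

theorem integral_log_mul_exp_neg :
    ∫ t in Ioi (0 : ℝ), (Real.log t : ℂ) * Complex.exp (-t) =
      -(Real.eulerMascheroniConstant : ℂ) := by
  have h1 := Complex.hasDerivAt_GammaIntegral (s := 1) (by simp)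
  have h2 : Complex.Gamma =ᶠ[𝓝 1] Complex.GammaIntegral := by
    filter_upwards [(isOpen_lt continuous_const Complex.continuous_re).mem_nhds
      (show (0 : ℝ) < (1 : ℂ).re by simp)] with s hs
    exact Complex.Gamma_eq_integral hs
  simpa using (h1.congr_of_eventuallyEq h2).unique Complex.hasDerivAt_Gamma_one

theorem integrableOn_log_mul_exp_neg :
    IntegrableOn (fun t : ℝ => (Real.log t : ℂ) * Complex.exp (-t)) (Ioi 0) := by
  by_contra h
  have h0 := integral_undef h
  rw [integral_log_mul_exp_neg, neg_eq_zero, Complex.ofReal_eq_zero] at h0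
  linarith [Real.one_half_lt_eulerMascheroniConstant]

/-- The expansion of the exponential integral `E₁` at a positive real number. -/
theorem integral_Ioi_exp_neg_mul_inv {r R : ℝ} (hr : 0 < r) (hR : r < R)
    {G : ℂ → ℂ} (hG0 : G 0 = 0) (hGd : ∀ z ∈ ball (0 : ℂ) R, DifferentiableAt ℂ G z)
    (hG : ∀ z ∈ ball (0 : ℂ) R, z ≠ 0 → HasDerivAt G ((Complex.exp (-z) - 1) / z) z) :
    ∫ t in Ioi r, Complex.exp (-(t : ℂ)) * (t : ℂ)⁻¹ =
      -(Real.eulerMascheroniConstant : ℂ) - Real.log r - G r := by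
  have hlog : ∀ t : ℝ, 0 < t → HasDerivAt (fun x : ℝ => (Real.log x : ℂ)) (t : ℂ)⁻¹ t :=
    fun t ht => by simpa using (Real.hasDerivAt_log ht.ne').ofReal_comp
  have hexp : ∀ t : ℝ, HasDerivAt (fun x : ℝ => Complex.exp (-(x : ℂ))) (-Complex.exp (-(t : ℂ))) t :=
    fun t => by simpa using (Complex.ofRealCLM.hasDerivAt (x := t)).neg.cexp
  have hint := integrableOn_log_mul_exp_neg
  have hle : IntegrableOn (fun t : ℝ => (Real.log t : ℂ) * Complex.exp (-t)) (Ioc 0 r) :=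
    hint.mono_set Ioc_subset_Ioi_self
  have hgt : IntegrableOn (fun t : ℝ => (Real.log t : ℂ) * Complex.exp (-t)) (Ioi r) :=
    hint.mono_set (Ioi_subset_Ioi hr.le)
  have hE1 : IntegrableOn (fun t : ℝ => Complex.exp (-(t : ℂ)) * (t : ℂ)⁻¹) (Ioi r) := by
    simpa using integrableOn_exp_mul_inv_pow (w := 1) (by simp) hr 1
  have hmem : ∀ t : ℝ, 0 ≤ t → t ≤ r → (t : ℂ) ∈ ball (0 : ℂ) R := fun t h0 ht => by
    simpa [abs_of_nonneg h0] using ht.trans_lt hR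
  have hGt : ∀ t : ℝ, 0 ≤ t → t ≤ r → ContinuousAt (fun x : ℝ => G x) t := fun t h0 ht =>
    (hGd _ (hmem t h0 ht)).continuousAt.comp (f := fun x : ℝ => (x : ℂ)) (by fun_prop)
  -- the integral over `(0, r]`
  have hA : ∫ t in (0:ℝ)..r, (Real.log t : ℂ) * Complex.exp (-t) =
      ((1 - Complex.exp (-r)) * Real.log r + G r) - 0 := by
    refine intervalIntegral.integral_eq_sub_of_hasDerivAt_of_tendsto
      (f := fun t : ℝ => (1 - Complex.exp (-t)) * Real.log t + G t) hr (fun t ht => ?_)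
      ((intervalIntegrable_iff_integrableOn_Ioc_of_le hr.le).2 hle) ?_ ?_
    · have hne : (t : ℂ) ≠ 0 := by exact_mod_cast ht.1.ne'
      have hGd' := (hG _ (hmem t ht.1.le ht.2.le) hne).comp_ofReal
      refine ((((hexp t).const_sub 1).mul (hlog t ht.1)).add hGd').congr_deriv ?_
      field_simp
      ring
    · have hz : Tendsto (fun t : ℝ => (1 - Complex.exp (-t)) * Real.log t) (𝓝[>] 0) (𝓝 0) := by
        have hxlog := (Real.continuous_mul_log.tendsto 0).norm.mono_left
          (nhdsWithin_le_nhds (s := Ioi 0))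
        refine squeeze_zero_norm' ?_ (by simpa using hxlog)
        filter_upwards [self_mem_nhdsWithin] with t ht
        have ht' : 0 ≤ t := le_of_lt ht
        have h1 : (1 : ℂ) - Complex.exp (-t) = ((1 - Real.exp (-t) : ℝ) : ℂ) := by push_cast; rfl
        rw [h1, norm_mul, Complex.norm_real, Complex.norm_real, Real.norm_eq_abs, Real.norm_eq_abs,
          abs_of_nonneg (by simpa using ht')]
        simp only [abs_of_nonneg ht']
        gcongr
        linarith [Real.add_one_le_exp (-t)]
      simpa [hG0] using hz.add ((hGt 0 le_rfl hr.le).tendsto.mono_left nhdsWithin_le_nhds)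
    · exact ((((hexp r).continuousAt.const_sub 1).mul (hlog r hr).continuousAt).add
        (hGt r hr.le le_rfl)).mono_left nhdsWithin_le_nhds
  -- the integral over `(r, ∞)`
  have hB := integral_Ioi_of_hasDerivAt_of_tendsto' (a := r) (m := 0)
    (f := fun t : ℝ => -(Real.log t * Complex.exp (-t)))
    (f' := fun t : ℝ => (Real.log t : ℂ) * Complex.exp (-t) - Complex.exp (-(t : ℂ)) * (t : ℂ)⁻¹)
    (fun t ht => (((hlog t (hr.trans_le ht)).mul (hexp t)).neg).congr_deriv (by ring))
    (hgt.sub hE1) (by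
      refine squeeze_zero_norm' ?_ (tendsto_rpow_mul_exp_neg_mul_atTop_nhds_zero 1 1 one_pos)
      filter_upwards [eventually_ge_atTop 1] with t ht
      have h1 := norm_exp_neg_mul_ofReal 1 t
      simp only [neg_mul, one_mul, Complex.one_re] at h1
      rw [norm_neg, norm_mul, h1, Complex.norm_real, Real.norm_of_nonneg (Real.log_nonneg ht)]
      simp only [Real.rpow_one, neg_mul, one_mul]
      gcongr
      linarith [Real.log_le_sub_one_of_pos (zero_lt_one.trans_le ht)])
  rw [integral_sub hgt hE1] at hB
  rw [intervalIntegral.integral_of_le hr.le] at hA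
  have hsplit := setIntegral_union (Ioc_disjoint_Ioi le_rfl) measurableSet_Ioi hle hgt
  rw [Ioc_union_Ioi_eq_Ioi hr.le, integral_log_mul_exp_neg, hA] at hsplit
  linear_combination -hsplit - hB

theorem hasDerivAt_integral_Ioi_exp_mul_inv {w : ℂ} (hw : 0 < w.re) {r : ℝ} (hr : 0 < r) :
    HasDerivAt (fun z : ℂ => ∫ t in Ioi r, Complex.exp (-z * t) * (t : ℂ)⁻¹)
      (-Complex.exp (-w * r) / w) w := by
  have hs : {z : ℂ | w.re / 2 < z.re} ∈ 𝓝 w :=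
    (isOpen_lt continuous_const Complex.continuous_re).mem_nhds (by simpa using hw)
  have h := (hasDerivAt_integral_of_dominated_loc_of_deriv_le (μ := volume.restrict (Ioi r))
    (F := fun (z : ℂ) (t : ℝ) => Complex.exp (-z * t) * (t : ℂ)⁻¹)
    (F' := fun (z : ℂ) (t : ℝ) => -Complex.exp (-z * t))
    (bound := fun t => Real.exp (-(w.re / 2) * t)) hs
    (Eventually.of_forall fun z => Measurable.aestronglyMeasurable (by fun_prop))
    (by simpa [IntegrableOn] using integrableOn_exp_mul_inv_pow hw hr 1)
    (Measurable.aestronglyMeasurable (by fun_prop)) ?_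
    (integrableOn_exp_mul_Ioi (by linarith) r) ?_).2
  · rw [integral_neg, integral_exp_mul_complex_Ioi (by simpa using hw)] at h
    exact h.congr_deriv (by simp [neg_div, div_neg])
  · filter_upwards [ae_restrict_mem measurableSet_Ioi] with t ht z hz
    rw [norm_neg, norm_exp_neg_mul_ofReal]
    have ht' : 0 ≤ t := (hr.trans ht).le
    have hz' : w.re / 2 < z.re := hz
    gcongr
  · filter_upwards [ae_restrict_mem measurableSet_Ioi] with t ht z _
    have hne : (t : ℂ) ≠ 0 := by exact_mod_cast (hr.trans ht).ne'
    refine ((((hasDerivAt_id z).neg.mul_const (t : ℂ)).cexp).mul_const (t : ℂ)⁻¹).congr_deriv ?_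
    simp [hne]

/-- The expansion of the exponential integral on the right half-plane. -/
theorem integral_Ioi_exp_mul_inv {w : ℂ} (hw : 0 < w.re) {r R : ℝ} (hr : 0 < r) (hrR : r < R)
    (hR : ‖w‖ * r < R) {G : ℂ → ℂ} (hG0 : G 0 = 0)
    (hGd : ∀ z ∈ ball (0 : ℂ) R, DifferentiableAt ℂ G z)
    (hG : ∀ z ∈ ball (0 : ℂ) R, z ≠ 0 → HasDerivAt G ((Complex.exp (-z) - 1) / z) z) :
    ∫ t in Ioi r, Complex.exp (-w * t) * (t : ℂ)⁻¹ =
      -(Real.eulerMascheroniConstant : ℂ) - Real.log r - Complex.log w - G (w * r) := by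
  have hc : (r : ℂ) ≠ 0 := by exact_mod_cast hr.ne'
  set U : Set ℂ := {z : ℂ | 0 < z.re} ∩ ball 0 (R / r) with hU
  have hUo : IsOpen U := (isOpen_lt continuous_const Complex.continuous_re).inter isOpen_ball
  have hUc : Convex ℝ U := (convex_halfSpace_re_gt 0).inter (convex_ball _ _)
  have hder : ∀ z ∈ U, HasDerivAt (fun z : ℂ =>
      (∫ t in Ioi r, Complex.exp (-z * t) * (t : ℂ)⁻¹) + (G (z * r) + Complex.log z)) 0 z := by
    rintro z ⟨hz, hzR⟩
    have hz0 : z ≠ 0 := by rintro rfl; simp at hz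
    have hzr : z * r ∈ ball (0 : ℂ) R := by
      rw [mem_ball_zero_iff, lt_div_iff₀ hr] at hzR
      simpa [abs_of_pos hr] using hzR
    have hGz := (hG _ hzr (mul_ne_zero hz0 hc)).comp z ((hasDerivAt_id z).mul_const (r : ℂ))
    refine ((hasDerivAt_integral_Ioi_exp_mul_inv hz hr).add
      (hGz.add (Complex.hasDerivAt_log (Or.inl hz)))).congr_deriv ?_
    simp only [neg_mul]
    field_simp
    ring
  have hconst := hUo.is_const_of_deriv_eq_zero hUc.isPreconnected
    (fun z hz => (hder z hz).differentiableAt.differentiableWithinAt)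
    (fun z hz => (hder z hz).deriv) (x := w) (y := 1)
    ⟨hw, by simpa [lt_div_iff₀ hr] using hR⟩
    ⟨by simp, by simpa [lt_div_iff₀ hr] using hrR⟩
  simp only [neg_mul, one_mul, Complex.log_one,
    integral_Ioi_exp_neg_mul_inv hr hrR hG0 hGd hG] at hconst
  simp only [neg_mul]
  linear_combination hconst

/-- The Hankel contour integral, with the circle parametrised and natural number powers. -/
theorem hankel_eval {w : ℂ} (hw : 0 < w.re) (n : ℕ) {r : ℝ} (hr : 0 < r) :
    (∫ t in Ioi r, Complex.exp (-w * t) * ((t : ℂ) ^ (n + 1))⁻¹) +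
    (1 / (2 * (Real.pi : ℂ))) * (∫ θ in (0:ℝ)..(2 * Real.pi),
        Complex.exp (-w * (r * Complex.exp (Complex.I * θ))) *
        ((r * Complex.exp (Complex.I * θ)) ^ n)⁻¹ * (Real.log r + Complex.I * θ)) +
    ((Real.eulerMascheroniConstant : ℂ) - Real.pi * Complex.I) *
      ((-w) ^ n / (n.factorial : ℂ)) =
    ((-w) ^ n / (n.factorial : ℂ)) *
      ((∑ j ∈ Finset.range n, (1 : ℂ) / (j + 1)) - Complex.log w) := by
  have hpi : (Real.pi : ℂ) ≠ 0 := by exact_mod_cast Real.pi_ne_zero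
  induction n with
  | zero =>
    have hw0 : w ≠ 0 := by rintro rfl; simp at hw
    have hrR : r < (1 + ‖w‖) * r + 1 := by nlinarith [mul_nonneg (norm_nonneg w) hr.le]
    have hwR : ‖w‖ * r < (1 + ‖w‖) * r + 1 := by linarith
    obtain ⟨G, hG0, hGd, hG⟩ := exists_primitive_exp_neg_sub_one_div ((1 + ‖w‖) * r + 1)
    simp only [zero_add, pow_one, pow_zero, inv_one, mul_one, Nat.factorial_zero, Nat.cast_one,
      div_one, Finset.range_zero, Finset.sum_empty,
      integral_Ioi_exp_mul_inv hw hr hrR hwR hG0 hGd hG,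
      integral_circle_log_zero hw0 hr hwR _ hG0 hGd hG]
    field_simp
    ring
  | succ n ih =>
    have hn : (n + 1 : ℂ) ≠ 0 := by exact_mod_cast n.succ_ne_zero
    have hf : (n.factorial : ℂ) ≠ 0 := by exact_mod_cast n.factorial_ne_zero
    have hA := integral_Ioi_exp_mul_inv_pow_succ hw hr n
    have hM := integral_circle_log_succ w hr n (Real.log r)
    have ha : (n + 1 : ℂ) * ((-w) ^ (n + 1) / ((n + 1).factorial : ℂ)) =
        -w * ((-w) ^ n / (n.factorial : ℂ)) := by
      rw [Nat.factorial_succ]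
      push_cast
      field_simp
      ring
    apply mul_left_cancel₀ hn
    rw [Finset.sum_range_succ]
    generalize (-w) ^ (n + 1) / ((n + 1).factorial : ℂ) = b at *
    have hinv : (n + 1 : ℂ) * (1 / (n + 1)) = 1 := by field_simp
    have hpi2 : 1 / (2 * (Real.pi : ℂ)) * (2 * Real.pi) = 1 := by field_simp
    linear_combination hA + 1 / (2 * (Real.pi : ℂ)) * hM - w * ih +
      (Real.eulerMascheroniConstant - Real.pi * Complex.I -
        (∑ j ∈ Finset.range n, (1 : ℂ) / (j + 1)) + Complex.log w) * ha - b * hinv +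
      (b - Complex.exp (-w * r) * ((r : ℂ) ^ (n + 1))⁻¹) * hpi2

/-- Explicit evaluation of the modified BM gamma function for `r = 0`:
for `Re w > 0`, `n ≥ 0` and `λ > 0`,
`P_0(n,w;∅) = ((-1)^n/n!)·(H_n - Log w)·w^n`, where `P_0(n,w;∅)` is written out as
`∫_λ^∞ e^{-wt} t^{-n-1} dt + (1/(2πi)) ∫_0^{2π} e^{-wλe^{iθ}} λ^{-n} e^{-inθ}(log λ + iθ) i dθ
 + (γ - πi)·(-w)^n/n!`. -/
theorem P_zero_eval (w : ℂ) (hw : 0 < w.re) (n : ℕ) (lam : ℝ) (hlam : 0 < lam) :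
    (∫ t in Set.Ioi lam, Complex.exp (-w * t) * (t : ℂ) ^ (-(n : ℤ) - 1)) +
    (1 / (2 * (Real.pi : ℂ) * Complex.I)) *
      (∫ θ in (0:ℝ)..(2 * Real.pi),
        Complex.exp (-w * (lam * Complex.exp (Complex.I * θ))) *
        (lam : ℂ) ^ (-(n : ℤ)) * Complex.exp (-Complex.I * (n : ℂ) * θ) *
        ((Real.log lam : ℂ) + Complex.I * θ) * Complex.I) +
    ((Real.eulerMascheroniConstant : ℂ) - Real.pi * Complex.I) *
      ((-w) ^ n / (n.factorial : ℂ)) =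
    ((-1 : ℂ) ^ n / (n.factorial : ℂ)) *
      ((∑ j ∈ Finset.range n, (1 : ℂ) / (j + 1)) - Complex.log w) * w ^ n := by
  have h := hankel_eval hw n hlam
  have h1 : ∀ t : ℝ, (t : ℂ) ^ (-(n : ℤ) - 1) = ((t : ℂ) ^ (n + 1))⁻¹ := fun t => by
    rw [← zpow_natCast, ← zpow_neg]
    congr 1
    push_cast
    ring
  have h2 : ∀ θ : ℝ, Complex.exp (-w * (lam * Complex.exp (Complex.I * θ))) *
        (lam : ℂ) ^ (-(n : ℤ)) * Complex.exp (-Complex.I * (n : ℂ) * θ) *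
        ((Real.log lam : ℂ) + Complex.I * θ) * Complex.I =
      Complex.exp (-w * (lam * Complex.exp (Complex.I * θ))) *
        ((lam * Complex.exp (Complex.I * θ)) ^ n)⁻¹ * (Real.log lam + Complex.I * θ) *
        Complex.I := fun θ => by
    have he : Complex.exp (-Complex.I * (n : ℂ) * θ) = (Complex.exp (Complex.I * θ) ^ n)⁻¹ := by
      rw [← Complex.exp_nat_mul, ← Complex.exp_neg]
      congr 1
      ring
    rw [he, zpow_neg, zpow_natCast, mul_pow, mul_inv]
    ring
  have hpi : (Real.pi : ℂ) ≠ 0 := by exact_mod_cast Real.pi_ne_zero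
  have h3 : ∀ x : ℂ, 1 / (2 * (Real.pi : ℂ) * Complex.I) * (x * Complex.I) =
      1 / (2 * (Real.pi : ℂ)) * x := fun x => by
    field_simp
  simp only [h1, h2, intervalIntegral.integral_mul_const, h3]
  rw [h, neg_pow w]
  ring
end

section
/- Let r, l ≥ 0 be integers, ω = (ω_1,…,ω_r) and α = (α_1,…,α_l) tuples of complex numbers with positive real parts, a ∈ ℂ, and k an integer with k ≥ −(r+l). Then there exist constants C > 0 and w_0 > 0 such that for every real w ≥ w_0: | ∫_0^∞ f_ω(t) e^{−wt} ( f_α(t)e^{−at} − ∑_{N=−l}^{r+k} a_{l,N}(a;α) t^N ) t^{−k−1} dt | ≤ C/w; that is, this integral is O(1/w) as real w → +∞. -/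
/-- `fprod r ω t = ∏_{j=1}^r (1 - exp(-ω_j t))⁻¹` (empty product = 1). -/
noncomputable def fprod (r : ℕ) (ω : Fin r → ℂ) (t : ℂ) : ℂ :=
  ∏ j, (1 - Complex.exp (-(ω j) * t))⁻¹

/-- `IsMBernoulli r ω w a` says that `a : ℤ → ℂ` is the family of multiple Bernoulli
polynomial values `a_{r,n}(w;ω)`: the Laurent coefficients of `f_ω(t)·exp(-wt)` at `t = 0`,
i.e. `a n` is the `(n+r)`-th Taylor coefficient at `0` of the holomorphic extension of
`t^r · f_ω(t) · exp(-wt)`, with `a n = 0` for `n < -r`. -/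
def IsMBernoulli (r : ℕ) (ω : Fin r → ℂ) (w : ℂ) (a : ℤ → ℂ) : Prop :=
  (∀ n : ℤ, n < -(r : ℤ) → a n = 0) ∧
  ∃ g : ℂ → ℂ, AnalyticAt ℂ g 0 ∧
    (∀ᶠ t in nhdsWithin (0 : ℂ) {(0 : ℂ)}ᶜ,
      g t = t ^ r * fprod r ω t * Complex.exp (-w * t)) ∧
    (∀ n : ℤ, -(r : ℤ) ≤ n →
      a n = iteratedDeriv (n + r).toNat g 0 / ((n + r).toNat.factorial : ℂ))

open Filter Asymptotics Topology

/-- A function on the reals is exponentially bounded on `s` if it is at most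
`M * exp (c * t)` in norm there, for some `c, M ≥ 0`. -/
def ExpBoundedOn (s : Set ℝ) (f : ℝ → ℂ) : Prop :=
  ∃ c : ℝ, 0 ≤ c ∧ ∃ M : ℝ, 0 ≤ M ∧ ∀ t ∈ s, ‖f t‖ ≤ M * Real.exp (c * t)

namespace ExpBoundedOn

variable {s : Set ℝ} {f g : ℝ → ℂ}

lemma mul (hf : ExpBoundedOn s f) (hg : ExpBoundedOn s g) :
    ExpBoundedOn s fun t => f t * g t := by
  obtain ⟨c, hc, M, hM, h⟩ := hf
  obtain ⟨d, hd, L, hL, h'⟩ := hg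
  refine ⟨c + d, by positivity, M * L, by positivity, fun t ht => ?_⟩
  calc ‖f t * g t‖ = ‖f t‖ * ‖g t‖ := norm_mul _ _
    _ ≤ (M * Real.exp (c * t)) * (L * Real.exp (d * t)) := by
      gcongr
      exacts [h t ht, h' t ht]
    _ = M * L * Real.exp ((c + d) * t) := by rw [add_mul, Real.exp_add]; ring

lemma add (hs : s ⊆ Set.Ioi 0) (hf : ExpBoundedOn s f) (hg : ExpBoundedOn s g) :
    ExpBoundedOn s fun t => f t + g t := by
  obtain ⟨c, hc, M, hM, h⟩ := hf
  obtain ⟨d, hd, L, hL, h'⟩ := hg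
  refine ⟨c + d, by positivity, M + L, by positivity, fun t ht => ?_⟩
  have ht0 : 0 < t := hs ht
  calc ‖f t + g t‖ ≤ ‖f t‖ + ‖g t‖ := norm_add_le _ _
    _ ≤ M * Real.exp (c * t) + L * Real.exp (d * t) := add_le_add (h t ht) (h' t ht)
    _ ≤ M * Real.exp ((c + d) * t) + L * Real.exp ((c + d) * t) := by
      gcongr <;> linarith
    _ = (M + L) * Real.exp ((c + d) * t) := by ring

lemma const (z : ℂ) : ExpBoundedOn s fun _ => z :=
  ⟨0, le_rfl, ‖z‖, norm_nonneg z, fun t _ => by simp⟩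

lemma sum (hs : s ⊆ Set.Ioi 0) {ι : Type*} (S : Finset ι) {F : ι → ℝ → ℂ}
    (hF : ∀ i ∈ S, ExpBoundedOn s (F i)) : ExpBoundedOn s fun t => ∑ i ∈ S, F i t := by
  classical
  induction S using Finset.induction_on with
  | empty => simpa using const 0
  | insert i S hi ih =>
    simp only [Finset.sum_insert hi]
    exact add hs (hF i (by simp)) (ih fun j hj => hF j (by simp [hj]))

lemma sub (hs : s ⊆ Set.Ioi 0) (hf : ExpBoundedOn s f) (hg : ExpBoundedOn s g) :
    ExpBoundedOn s fun t => f t - g t := by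
  simpa [sub_eq_add_neg] using add hs hf ((const (-1)).mul hg)

lemma cexp (hs : s ⊆ Set.Ioi 0) (z : ℂ) : ExpBoundedOn s fun t => Complex.exp (z * t) := by
  refine ⟨|z.re|, abs_nonneg _, 1, zero_le_one, fun t ht => ?_⟩
  have ht0 : 0 < t := hs ht
  rw [Complex.norm_exp, one_mul, Complex.re_mul_ofReal]
  gcongr
  exact le_abs_self _

lemma zpow {δ : ℝ} (hδ : 0 < δ) (m : ℤ) :
    ExpBoundedOn (Set.Ici δ) fun t => (t : ℂ) ^ m := by
  obtain ⟨n, rfl | rfl⟩ := m.eq_nat_or_neg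
  · refine ⟨1, zero_le_one, n.factorial, by positivity, fun t ht => ?_⟩
    have ht0 : 0 < t := hδ.trans_le ht
    have h := Real.pow_div_factorial_le_exp t ht0.le n
    rw [div_le_iff₀ (by positivity)] at h
    simpa [abs_of_pos ht0, mul_comm] using h
  · refine ⟨0, le_rfl, (δ ^ n)⁻¹, by positivity, fun t ht => ?_⟩
    have ht0 : 0 < t := hδ.trans_le ht
    have h : δ ≤ t := ht
    simp only [zpow_neg, zpow_natCast, norm_inv, norm_pow, Complex.norm_real, Real.norm_eq_abs,
      abs_of_pos ht0, zero_mul, Real.exp_zero, mul_one]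
    gcongr

lemma union {s' : Set ℝ} (hs : s ⊆ Set.Ioi 0) (hs' : s' ⊆ Set.Ioi 0)
    (h : ExpBoundedOn s f) (h' : ExpBoundedOn s' f) : ExpBoundedOn (s ∪ s') f := by
  obtain ⟨c, hc, M, hM, h⟩ := h
  obtain ⟨d, hd, L, hL, h'⟩ := h'
  refine ⟨c + d, by positivity, M + L, by positivity, ?_⟩
  rintro t (ht | ht)
  · have ht0 : 0 < t := hs ht
    refine (h t ht).trans ?_
    gcongr <;> linarith
  · have ht0 : 0 < t := hs' ht
    refine (h' t ht).trans ?_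
    gcongr <;> linarith

lemma norm_integral_le (hf : ExpBoundedOn (Set.Ioi 0) f) :
    ∃ C > (0 : ℝ), ∃ w₀ > (0 : ℝ), ∀ w : ℝ, w₀ ≤ w →
      ‖∫ t in Set.Ioi (0 : ℝ), Complex.exp (-(w : ℂ) * t) * f t‖ ≤ C / w := by
  obtain ⟨c, hc, M, hM, h⟩ := hf
  refine ⟨2 * M + 1, by positivity, 2 * c + 1, by positivity, fun w hw => ?_⟩
  have hneg : c - w < 0 := by linarith
  have hint := (integrableOn_exp_mul_Ioi hneg 0).const_mul M
  have hb : ∀ t ∈ Set.Ioi (0 : ℝ),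
      ‖Complex.exp (-(w : ℂ) * t) * f t‖ ≤ M * Real.exp ((c - w) * t) := fun t ht => by
    calc ‖Complex.exp (-(w : ℂ) * t) * f t‖ = Real.exp (-w * t) * ‖f t‖ := by
          rw [norm_mul, Complex.norm_exp, Complex.re_mul_ofReal, Complex.neg_re, Complex.ofReal_re]
      _ ≤ Real.exp (-w * t) * (M * Real.exp (c * t)) := by gcongr; exact h t ht
      _ = M * Real.exp ((c - w) * t) := by
          rw [show (c - w) * t = -w * t + c * t by ring, Real.exp_add]; ring
  refine (MeasureTheory.norm_integral_le_of_norm_le hint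
    (MeasureTheory.ae_restrict_of_forall_mem measurableSet_Ioi hb)).trans ?_
  rw [MeasureTheory.integral_const_mul, integral_exp_mul_Ioi hneg]
  have hw0 : 0 < w := by linarith
  have hwc : 0 < w - c := by linarith
  have : M * (-Real.exp ((c - w) * 0) / (c - w)) = M / (w - c) := by
    rw [mul_zero, Real.exp_zero, neg_div, ← div_neg, neg_sub, mul_one_div]
  rw [this, div_le_div_iff₀ hwc hw0]
  nlinarith

end ExpBoundedOn

lemma norm_one_sub_cexp_inv_le {z : ℂ} (hz : 0 < z.re) {t : ℝ} (ht : 0 < t) :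
    ‖(1 - Complex.exp (-z * t))⁻¹‖ ≤ (1 + z.re⁻¹) * (1 + t⁻¹) := by
  have hx : 0 < z.re * t := mul_pos hz ht
  have hexp : Real.exp (-(z.re * t)) ≤ (1 + z.re * t)⁻¹ := by
    rw [Real.exp_neg]
    gcongr
    linarith [Real.add_one_le_exp (z.re * t)]
  have hnorm : 1 - Real.exp (-(z.re * t)) ≤ ‖1 - Complex.exp (-z * t)‖ := by
    have h := norm_sub_norm_le (1 : ℂ) (Complex.exp (-z * t))
    rwa [norm_one, Complex.norm_exp, Complex.re_mul_ofReal, Complex.neg_re, neg_mul] at h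
  have hlow : (z.re * t) / (1 + z.re * t) ≤ ‖1 - Complex.exp (-z * t)‖ := by
    have h : (z.re * t) / (1 + z.re * t) = 1 - (1 + z.re * t)⁻¹ := by field_simp; ring
    linarith
  calc ‖(1 - Complex.exp (-z * t))⁻¹‖ ≤ ((z.re * t) / (1 + z.re * t))⁻¹ := by
        rw [norm_inv]; gcongr
    _ = 1 + z.re⁻¹ * t⁻¹ := by field_simp; ring
    _ ≤ (1 + z.re⁻¹) * (1 + t⁻¹) := by
        have := inv_pos.2 hz
        have := inv_pos.2 ht
        linarith

lemma norm_fprod_le {r : ℕ} {ω : Fin r → ℂ} (hω : ∀ j, 0 < (ω j).re) {t : ℝ} (ht : 0 < t) :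
    ‖fprod r ω t‖ ≤ (∏ j, (1 + (ω j).re⁻¹)) * (1 + t⁻¹) ^ r := by
  have h : ‖fprod r ω t‖ ≤ ∏ j, ((1 + (ω j).re⁻¹) * (1 + t⁻¹)) := by
    rw [fprod, norm_prod]
    exact Finset.prod_le_prod (fun _ _ => norm_nonneg _)
      fun j _ => norm_one_sub_cexp_inv_le (hω j) ht
  simpa [Finset.prod_mul_distrib] using h

lemma expBoundedOn_fprod {r : ℕ} {ω : Fin r → ℂ} (hω : ∀ j, 0 < (ω j).re) {δ : ℝ} (hδ : 0 < δ) :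
    ExpBoundedOn (Set.Ici δ) fun t => fprod r ω t := by
  have hP : 0 ≤ ∏ j, (1 + (ω j).re⁻¹) :=
    Finset.prod_nonneg fun j _ => by have := inv_pos.2 (hω j); positivity
  refine ⟨0, le_rfl, (∏ j, (1 + (ω j).re⁻¹)) * (1 + δ⁻¹) ^ r, by positivity, fun t ht => ?_⟩
  have hδt : δ ≤ t := ht
  have ht0 : 0 < t := hδ.trans_le hδt
  refine (norm_fprod_le hω ht0).trans ?_
  rw [zero_mul, Real.exp_zero, mul_one]
  gcongr

lemma isBigO_pow_mul_fprod {r : ℕ} {ω : Fin r → ℂ} (hω : ∀ j, 0 < (ω j).re) :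
    (fun t : ℝ => (t : ℂ) ^ r * fprod r ω t) =O[𝓝[>] 0] fun _ => (1 : ℝ) := by
  have hP : 0 ≤ ∏ j, (1 + (ω j).re⁻¹) :=
    Finset.prod_nonneg fun j _ => by have := inv_pos.2 (hω j); positivity
  refine IsBigO.of_bound ((∏ j, (1 + (ω j).re⁻¹)) * 2 ^ r) ?_
  filter_upwards [Ioo_mem_nhdsGT (zero_lt_one' ℝ)] with t ht
  have ht0 : 0 < t := ht.1
  calc ‖(t : ℂ) ^ r * fprod r ω t‖ = t ^ r * ‖fprod r ω t‖ := by
        simp [abs_of_pos ht0]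
    _ ≤ t ^ r * ((∏ j, (1 + (ω j).re⁻¹)) * (1 + t⁻¹) ^ r) := by
        gcongr; exact norm_fprod_le hω ht0
    _ = (∏ j, (1 + (ω j).re⁻¹)) * (t + 1) ^ r := by
        rw [show t + 1 = t * (1 + t⁻¹) by field_simp, mul_pow]; ring
    _ ≤ (∏ j, (1 + (ω j).re⁻¹)) * 2 ^ r := by gcongr; linarith [ht.2]
    _ = _ := by simp

lemma AnalyticAt.isBigO_sub_taylor {g : ℂ → ℂ} (hg : AnalyticAt ℂ g 0) (n : ℕ) :
    (fun z => g z - ∑ i ∈ Finset.range n, iteratedDeriv i g 0 / (i.factorial : ℂ) * z ^ i)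
      =O[𝓝 0] fun z => z ^ n := by
  have h := hg.hasFPowerSeriesAt.isBigO_sub_partialSum_pow n
  refine IsBigO.of_norm_right ?_
  simpa [FormalMultilinearSeries.partialSum, mul_comm] using h

lemma sum_Icc_zpow_mul_pow (B : ℤ → ℂ) (l m : ℕ) {z : ℂ} (hz : z ≠ 0) :
    z ^ l * ∑ N ∈ Finset.Icc (-(l : ℤ)) ((m : ℤ) - l), B N * z ^ N =
      ∑ i ∈ Finset.range (m + 1), B ((i : ℤ) - l) * z ^ i := by
  rw [Finset.mul_sum]
  symm
  refine Finset.sum_bij (fun i _ => (i : ℤ) - l) (fun i hi => ?_) (fun i _ j _ h => by simpa using h)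
    (fun N hN => ?_) (fun i _ => ?_)
  · simp only [Finset.mem_range, Finset.mem_Icc] at *
    omega
  · simp only [Finset.mem_Icc] at hN
    exact ⟨(N + l).toNat, by simp only [Finset.mem_range]; omega, by omega⟩
  · rw [zpow_sub₀ hz, zpow_natCast, zpow_natCast]
    field_simp

lemma IsMBernoulli.isBigO_remainder {l : ℕ} {α : Fin l → ℂ} {a : ℂ} {B : ℤ → ℂ}
    (hB : IsMBernoulli l α a B) (m : ℕ) :
    (fun t : ℝ => (t : ℂ) ^ l * (fprod l α t * Complex.exp (-a * t) -
      ∑ N ∈ Finset.Icc (-(l : ℤ)) ((m : ℤ) - l), B N * (t : ℂ) ^ N))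
      =O[𝓝[>] 0] fun t : ℝ => (t : ℂ) ^ (m + 1) := by
  obtain ⟨-, g, hg, hgf, hcoeff⟩ := hB
  have hlim : Tendsto (fun t : ℝ => (t : ℂ)) (𝓝[>] 0) (𝓝[≠] 0) := by
    refine tendsto_nhdsWithin_iff.2 ⟨?_, ?_⟩
    · exact (Complex.continuous_ofReal.tendsto' 0 0 (by simp)).mono_left nhdsWithin_le_nhds
    · filter_upwards [self_mem_nhdsWithin] with t ht
      simpa using ne_of_gt ht
  refine ((hg.isBigO_sub_taylor (m + 1)).comp_tendsto
    (hlim.mono_right nhdsWithin_le_nhds)).congr' ?_ .rfl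
  filter_upwards [hlim.eventually hgf, self_mem_nhdsWithin] with t hgt ht
  have htz : (t : ℂ) ≠ 0 := by simpa using ne_of_gt ht
  rw [Function.comp_apply, mul_sub, sum_Icc_zpow_mul_pow B l m htz, hgt, mul_assoc]
  congr 1
  refine Finset.sum_congr rfl fun i _ => ?_
  rw [hcoeff _ (by omega), sub_add_cancel, Int.toNat_natCast]

/-- The remainder integral is `O(1/w)` as real `w → +∞`:
there are `C > 0`, `w₀ > 0` such that for all real `w ≥ w₀`,
`|∫_0^∞ f_ω(t) e^{-wt} (f_α(t)e^{-at} - ∑_{N=-l}^{r+k} a_{l,N}(a;α) t^N) t^{-k-1} dt| ≤ C/w`. -/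
theorem remainder_integral_isBigO (r l : ℕ) (ω : Fin r → ℂ) (α : Fin l → ℂ)
    (hω : ∀ j, 0 < (ω j).re) (hα : ∀ j, 0 < (α j).re)
    (a : ℂ) (k : ℤ) (hk : -((r : ℤ) + l) ≤ k)
    (B : ℤ → ℂ) (hB : IsMBernoulli l α a B) :
    ∃ C > (0 : ℝ), ∃ w₀ > (0 : ℝ), ∀ w : ℝ, w₀ ≤ w →
      ‖∫ t in Set.Ioi (0 : ℝ), fprod r ω t * Complex.exp (-(w : ℂ) * t) *
          (fprod l α t * Complex.exp (-a * t) -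
            ∑ N ∈ Finset.Icc (-(l : ℤ)) ((r : ℤ) + k), B N * (t : ℂ) ^ N) *
          (t : ℂ) ^ (-k - 1)‖ ≤ C / w := by
  obtain ⟨m, hm⟩ : ∃ m : ℕ, (r : ℤ) + k = m - l := ⟨(r + k + l).toNat, by omega⟩
  rw [hm]
  set R : ℝ → ℂ := fun t => fprod l α t * Complex.exp (-a * t) -
    ∑ N ∈ Finset.Icc (-(l : ℤ)) ((m : ℤ) - l), B N * (t : ℂ) ^ N with hR
  have hlocal : (fun t : ℝ => fprod r ω t * R t * (t : ℂ) ^ (-k - 1))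
      =O[𝓝[>] 0] fun _ => (1 : ℝ) := by
    have h := ((isBigO_pow_mul_fprod hω).mul (hB.isBigO_remainder m).norm_right).mul
      (isBigO_refl (fun t : ℝ => ((t : ℂ) ^ (m + 1))⁻¹) (𝓝[>] 0)).norm_right
    refine h.congr' ?_ ?_
    · filter_upwards [self_mem_nhdsWithin] with t ht
      have htz : (t : ℂ) ≠ 0 := by simpa using ne_of_gt ht
      rw [show -k - 1 = (r : ℤ) + l - ((m + 1 : ℕ) : ℤ) by push_cast; omega, zpow_sub₀ htz,
        zpow_add₀ htz, zpow_natCast, zpow_natCast, zpow_natCast]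
      simp only [hR]
      ring
    · filter_upwards [self_mem_nhdsWithin] with t ht
      have htz : (t : ℂ) ≠ 0 := by simpa using ne_of_gt ht
      rw [one_mul, ← norm_mul, mul_inv_cancel₀ (pow_ne_zero _ htz), norm_one]
  obtain ⟨M, hM, hbound⟩ := hlocal.exists_nonneg
  obtain ⟨δ, hδ, hsub⟩ := mem_nhdsGT_iff_exists_Ioo_subset.1 hbound.bound
  have hδ0 : (0 : ℝ) < δ := hδ
  have hIci : Set.Ici δ ⊆ Set.Ioi (0 : ℝ) := Set.Ici_subset_Ioi.2 hδ0
  have hnear : ExpBoundedOn (Set.Ioo 0 δ) fun t => fprod r ω t * R t * (t : ℂ) ^ (-k - 1) :=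
    ⟨0, le_rfl, M, hM, fun t ht => by simpa using hsub ht⟩
  have hfar : ExpBoundedOn (Set.Ici δ) fun t => fprod r ω t * R t * (t : ℂ) ^ (-k - 1) :=
    ((expBoundedOn_fprod hω hδ0).mul (.sub hIci
      ((expBoundedOn_fprod hα hδ0).mul (.cexp hIci _))
      (.sum hIci _ fun N _ => (ExpBoundedOn.const _).mul (.zpow hδ0 N)))).mul (.zpow hδ0 _)
  have h := hnear.union Set.Ioo_subset_Ioi_self hIci hfar
  rw [Set.Ioo_union_Ici_eq_Ioi hδ0] at h
  obtain ⟨C, hC, w₀, hw₀, H⟩ := h.norm_integral_le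
  refine ⟨C, hC, w₀, hw₀, fun w hw => ?_⟩
  convert H w hw using 4 with t
  ring
end
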